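/- Boundedness of DRAO iterates (smooth convex case): in the smooth setting, run DRAO with stepsizes w_t = t, θ_t = (t−1)/t, τ_t = (t−1)/2, η_t = 2L_f/t, and let x* be a minimizer of f over X. Then every iterate satisfies ‖x^t − x*‖ ≤ ‖x⁰ − x*‖ for all t ≥ 1. -/

import Mathlib

open RealInnerProductSpace

section Aux
variable {E : Type*} [NormedAddCommGroup E] [InnerProductSpace ℝ E]

lemma aux_line [CompleteSpace E] {h : E → ℝ} (hd : Differentiable ℝ h) (x d : E) (s : ℝ) :
    HasDerivAt (fun s : ℝ => h (x + s • d)) ⟪gradient h (x + s • d), d⟫ s := by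
  have h1 : HasDerivAt (fun s : ℝ => x + s • d) d s := by
    simpa using ((hasDerivAt_id s).smul_const d).const_add x
  have h2 := (hd (x + s • d)).hasGradientAt.hasFDerivAt
  have := h2.comp_hasDerivAt s h1
  rw [InnerProductSpace.toDual_apply_apply] at this
  exact this

lemma aux_grad [CompleteSpace E] {h : E → ℝ} (hd : Differentiable ℝ h)
    (hc : ConvexOn ℝ Set.univ h) (x y : E) :
    h x + ⟪gradient h x, y - x⟫ ≤ h y := by
  have hcl : ConvexOn ℝ Set.univ (fun s : ℝ => h (x + s • (y - x))) := by
    refine ⟨convex_univ, fun a _ b _ p q hp hq hpq => ?_⟩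
    have := hc.2 (Set.mem_univ (x + a • (y - x))) (Set.mem_univ (x + b • (y - x))) hp hq hpq
    convert this using 2
    have : x = (p + q) • x := by rw [hpq, one_smul]
    simp only [smul_eq_mul]
    nth_rewrite 1 [this]
    module
  have hder := aux_line hd x (y - x) 0
  have := hcl.le_slope_of_hasDerivAt (Set.mem_univ 0) (Set.mem_univ 1) one_pos hder
  simp only [slope_def_field, zero_smul, add_zero, one_smul, add_sub_cancel, sub_zero,
    div_one] at this
  linarith

lemma aux_descent {h : E → ℝ} {g : E → E} {L : ℝ} (x d : E)
    (hg : ∀ s : ℝ, HasDerivAt (fun s : ℝ => h (x + s • d)) ⟪g (x + s • d), d⟫ s)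
    (hL : ∀ y, ‖g y - g x‖ ≤ L * ‖y - x‖) :
    h (x + d) ≤ h x + ⟪g x, d⟫ + L / 2 * ‖d‖ ^ 2 := by
  let φ : ℝ → ℝ := fun s => h (x + s • d) - s * ⟪g x, d⟫ - L / 2 * ‖d‖ ^ 2 * s ^ 2
  have hφ : ∀ s, HasDerivAt φ (⟪g (x + s • d), d⟫ - ⟪g x, d⟫ - L / 2 * ‖d‖ ^ 2 * (2 * s)) s := by
    intro s
    have h1 := (hasDerivAt_id s).mul_const ⟪g x, d⟫
    have h2 := (hasDerivAt_pow 2 s).const_mul (L / 2 * ‖d‖ ^ 2)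
    have := ((hg s).sub h1).sub h2
    exact this.congr_deriv (by simp)
  have hanti : AntitoneOn φ (Set.Icc 0 1) := by
    apply antitoneOn_of_deriv_nonpos (convex_Icc 0 1)
    · exact fun s _ => (hφ s).continuousAt.continuousWithinAt
    · exact fun s _ => (hφ s).differentiableAt.differentiableWithinAt
    · intro s hs
      rw [interior_Icc] at hs
      rw [(hφ s).deriv, ← inner_sub_left]
      have h1 := real_inner_le_norm (g (x + s • d) - g x) d
      have h2 := hL (x + s • d)
      rw [add_sub_cancel_left, norm_smul, Real.norm_of_nonneg hs.1.le] at h2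
      have h3 := mul_le_mul_of_nonneg_right h2 (norm_nonneg d)
      nlinarith
  have := hanti (Set.left_mem_Icc.2 zero_le_one) (Set.right_mem_Icc.2 zero_le_one) zero_le_one
  simp [φ] at this
  linarith

lemma aux_three {X : Set E} {G : E → ℝ} {c : ℝ} (hG : ConvexOn ℝ X G) {x y z : E}
    (hx : x ∈ X) (hz : z ∈ X)
    (hmin : IsMinOn (fun w => G w + c * ‖w - y‖ ^ 2) X x) :
    G x + c * ‖x - y‖ ^ 2 + c * ‖x - z‖ ^ 2 ≤ G z + c * ‖z - y‖ ^ 2 := by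
  have key : ∀ l : ℝ, 0 < l → l < 1 →
      G x + c * ‖x - y‖ ^ 2 + c * (1 - l) * ‖x - z‖ ^ 2 ≤ G z + c * ‖z - y‖ ^ 2 := by
    intro l h0 h1
    have hw := hG.1 hx hz (sub_nonneg.2 h1.le) h0.le (by ring)
    have hc := hG.2 hx hz (sub_nonneg.2 h1.le) h0.le (by ring)
    have hm : G x + c * ‖x - y‖ ^ 2 ≤ _ := hmin hw
    simp only [] at hm
    have e : ‖(1 - l) • x + l • z - y‖ ^ 2 = (1 - l) * ‖x - y‖ ^ 2 + l * ‖z - y‖ ^ 2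
        - l * (1 - l) * ‖x - z‖ ^ 2 := by
      have a1 : (1 - l) • x + l • z - y = (x - y) - l • ((x - y) - (z - y)) := by module
      have a2 : x - z = (x - y) - (z - y) := by abel
      rw [a1, a2]
      generalize x - y = a
      generalize z - y = b
      rw [norm_sub_sq_real, norm_smul, mul_pow, norm_sub_sq_real, inner_smul_right,
        inner_sub_right, real_inner_self_eq_norm_sq, Real.norm_eq_abs, sq_abs]
      ring
    rw [e] at hm
    simp only [smul_eq_mul] at hc
    refine le_of_mul_le_mul_left ?_ h0
    nlinarith
  have ht : Filter.Tendsto (fun l : ℝ => G x + c * ‖x - y‖ ^ 2 + c * (1 - l) * ‖x - z‖ ^ 2)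
      (nhdsWithin 0 (Set.Ioi 0))
      (nhds (G x + c * ‖x - y‖ ^ 2 + c * (1 - 0) * ‖x - z‖ ^ 2)) := by
    apply Filter.Tendsto.mono_left _ nhdsWithin_le_nhds
    exact Continuous.tendsto (by fun_prop) 0
  have := le_of_tendsto ht (by
    filter_upwards [Ioo_mem_nhdsGT (zero_lt_one' ℝ)] with l hl using key l hl.1 hl.2)
  simpa using this

/-- weighted average of the iterates -/
noncomputable def auxBar (x : ℕ → E) : ℕ → E
  | 0 => x 0
  | t + 1 => ((t : ℝ) / (t + 2)) • auxBar x t + ((2 : ℝ) / (t + 2)) • x (t + 1)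

lemma auxBar_sub (x xund : ℕ → E) (hxund0 : xund 0 = x 0)
    (hxund : ∀ t : ℕ, 1 ≤ t →
      xund t = (1 + ((t : ℝ) - 1) / 2)⁻¹ •
        ((x (t-1) + (((t : ℝ) - 1) / (t : ℝ)) • (x (t-1) - x (t-2)))
          + (((t : ℝ) - 1) / 2) • xund (t-1))) (t : ℕ) :
    auxBar x t = xund t + ((2 : ℝ) / (t + 1)) • (x t - x (t - 1)) := by
  induction t with
  | zero => simp [auxBar, hxund0]
  | succ t ih =>
    rw [auxBar, ih, hxund (t + 1) (by omega)]
    have e1 : t + 1 - 1 = t := rfl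
    have e2 : t + 1 - 2 = t - 1 := rfl
    rw [e1, e2]
    push_cast
    have h1 : (t : ℝ) + 1 ≠ 0 := by positivity
    have h2 : (t : ℝ) + 2 ≠ 0 := by positivity
    have e3 : (1 + ((t : ℝ) + 1 - 1) / 2)⁻¹ = 2 / (t + 2) := by
      rw [show (1 + ((t : ℝ) + 1 - 1) / 2) = (t + 2) / 2 by ring, inv_div]
    have e4 : (t : ℝ) + 1 + 1 = t + 2 := by ring
    have e5 : (t : ℝ) + 1 - 1 = t := by ring
    rw [e3, e4, e5]
    match_scalars <;> field_simp <;> ring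

lemma auxBar_mem {X : Set E} (hX : Convex ℝ X) {x : ℕ → E} (hx : ∀ t, x t ∈ X) (t : ℕ) :
    auxBar x t ∈ X := by
  induction t with
  | zero => exact hx 0
  | succ t ih =>
    exact hX ih (hx _) (by positivity) (by positivity) (by field_simp)

end Aux

/-- **Boundedness of DRAO iterates** (smooth convex case):
with `w_t = t`, `θ_t = (t−1)/t`, `τ_t = (t−1)/2`, `η_t = 2L_f/t`, every iterate satisfies
`‖x^t − x*‖ ≤ ‖x⁰ − x*‖` for all `t ≥ 1`.
-/
theorem DRAO_smooth_iterate_boundedness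
    (n m : ℕ) (hm : 1 ≤ m)
    (X : Set (EuclideanSpace ℝ (Fin n)))
    (hXne : X.Nonempty) (hXcl : IsClosed X) (hXcv : Convex ℝ X)
    (P : Set (Fin m → ℝ))
    (hPne : P.Nonempty) (hPcl : IsClosed P) (hPcv : Convex ℝ P)
    (hPsub : ∀ p ∈ P, (∑ i, p i) = 1 ∧ ∀ i, 0 ≤ p i)
    (u : EuclideanSpace ℝ (Fin n) → ℝ) (hucv : ConvexOn ℝ Set.univ u)
    (ρstar : (Fin m → ℝ) → ℝ)
    (hρcv : ConvexOn ℝ Set.univ ρstar) (hρlsc : LowerSemicontinuous ρstar)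
    -- smooth setting: each `f_i` convex differentiable with `L_i`-Lipschitz gradient
    (fi : Fin m → EuclideanSpace ℝ (Fin n) → ℝ)
    (hficv : ∀ i, ConvexOn ℝ Set.univ (fi i))
    (hfidiff : ∀ i, Differentiable ℝ (fi i))
    (Li : Fin m → ℝ)
    (hLi : ∀ i, ∀ x y : EuclideanSpace ℝ (Fin n),
      ‖gradient (fi i) x - gradient (fi i) y‖ ≤ Li i * ‖x - y‖)
    -- `L_f = sup_{p∈P} L_p`, the aggregate smoothness constant
    (Lf : ℝ) (hLfpos : 0 < Lf)
    (hLf : ∀ p ∈ P, ∀ x y : EuclideanSpace ℝ (Fin n),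
      ‖∑ i, p i • (gradient (fi i) x - gradient (fi i) y)‖ ≤ Lf * ‖x - y‖)
    -- the objective `f` and a minimizer `x*` of `f` over `X`
    (f : EuclideanSpace ℝ (Fin n) → ℝ)
    (hf : ∀ xx, IsLUB ((fun p => (∑ i, p i * fi i xx) - ρstar p) '' P) (f xx - u xx))
    (xstar : EuclideanSpace ℝ (Fin n)) (hxstarX : xstar ∈ X) (hxstar : IsMinOn f X xstar)
    -- DRAO iterates (convention `x⁻¹ = x⁰` via `ℕ`-subtraction), with
    -- `θ_t = (t−1)/t`, `τ_t = (t−1)/2`, `η_t = 2 L_f / t`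
    (x : ℕ → EuclideanSpace ℝ (Fin n)) (hx0 : x 0 ∈ X)
    (xund : ℕ → EuclideanSpace ℝ (Fin n)) (hxund0 : xund 0 = x 0)
    (hxund : ∀ t : ℕ, 1 ≤ t →
      xund t = (1 + ((t : ℝ) - 1) / 2)⁻¹ •
        ((x (t-1) + (((t : ℝ) - 1) / (t : ℝ)) • (x (t-1) - x (t-2)))
          + (((t : ℝ) - 1) / 2) • xund (t-1)))
    (hxupd : ∀ t : ℕ, 1 ≤ t → x t ∈ X ∧
      IsMinOn (fun xx =>
        sSup ((fun p =>
          (∑ i, p i * (fi i (xund t) + ⟪gradient (fi i) (xund t), xx - xund t⟫))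
            - ρstar p) '' P)
        + u xx + (2 * Lf / (t : ℝ)) / 2 * ‖xx - x (t-1)‖ ^ 2) X (x t)) :
    ∀ t : ℕ, 1 ≤ t → ‖x t - xstar‖ ≤ ‖x 0 - xstar‖ := by
  have hX : ∀ t, x t ∈ X := by
    intro t
    rcases Nat.eq_zero_or_pos t with rfl | h
    · exact hx0
    · exact (hxupd t h).1
  -- linear models
  set ell : (Fin m → ℝ) → EuclideanSpace ℝ (Fin n) → EuclideanSpace ℝ (Fin n) → ℝ :=
    fun p z xx => ∑ i, p i * (fi i z + ⟪gradient (fi i) z, xx - z⟫) with hell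
  have hell_le : ∀ p ∈ P, ∀ z xx, ell p z xx ≤ ∑ i, p i * fi i xx := by
    intro p hp z xx
    exact Finset.sum_le_sum fun i _ =>
      mul_le_mul_of_nonneg_left (aux_grad (hfidiff i) (hficv i) z xx) ((hPsub p hp).2 i)
  have hell_aff : ∀ p z a b (α β : ℝ), α + β = 1 →
      ell p z (α • a + β • b) = α * ell p z a + β * ell p z b := by
    intro p z a b α β hab
    simp only [hell, Finset.mul_sum, ← Finset.sum_add_distrib]
    refine Finset.sum_congr rfl fun i _ => ?_
    have : α • a + β • b - z = α • (a - z) + β • (b - z) := by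
      have : z = (α + β) • z := by rw [hab, one_smul]
      nth_rewrite 1 [this]
      module
    rw [this, inner_add_right, inner_smul_right, inner_smul_right]
    have : β = 1 - α := by linarith
    subst this
    ring
  have hsmooth : ∀ p ∈ P, ∀ z d,
      ∑ i, p i * fi i (z + d) ≤ ell p z (z + d) + Lf / 2 * ‖d‖ ^ 2 := by
    intro p hp z d
    have := aux_descent (h := fun y => ∑ i, p i * fi i y)
      (g := fun y => ∑ i, p i • gradient (fi i) y) (L := Lf) z d (by
        intro s
        have := HasDerivAt.fun_sum (u := Finset.univ) fun i _ =>
          (aux_line (hfidiff i) z d s).const_mul (p i)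
        simpa [sum_inner, real_inner_smul_left] using this) (by
        intro y
        have := hLf p hp y z
        simpa [smul_sub, Finset.sum_sub_distrib] using this)
    refine this.trans (le_of_eq ?_)
    simp [hell, sum_inner, real_inner_smul_left, mul_add, Finset.sum_add_distrib]
  have hbdd : ∀ z xx, ∀ v ∈ (fun p => ell p z xx - ρstar p) '' P, v ≤ f xx - u xx := by
    rintro z xx _ ⟨p, hp, rfl⟩
    have h1 := (hf xx).1 ⟨p, hp, rfl⟩
    have h2 := hell_le p hp z xx
    simp only at h1 ⊢
    linarith
  set F : EuclideanSpace ℝ (Fin n) → EuclideanSpace ℝ (Fin n) → ℝ :=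
    fun z xx => sSup ((fun p => ell p z xx - ρstar p) '' P) with hF
  have hle_F : ∀ p ∈ P, ∀ z xx, ell p z xx - ρstar p ≤ F z xx := fun p hp z xx =>
    le_csSup ⟨_, hbdd z xx⟩ ⟨p, hp, rfl⟩
  have hF_le : ∀ z xx, F z xx ≤ f xx - u xx := fun z xx =>
    csSup_le (hPne.image _) (hbdd z xx)
  have hFcv : ∀ z, ConvexOn ℝ X (fun xx => F z xx + u xx) := by
    intro z
    refine ConvexOn.add ⟨hXcv, ?_⟩ (hucv.subset (Set.subset_univ _) hXcv)
    intro a _ b _ α β hα hβ hab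
    refine csSup_le (hPne.image _) ?_
    rintro _ ⟨p, hp, rfl⟩
    have h1 := mul_le_mul_of_nonneg_left (hle_F p hp z a) hα
    have h2 := mul_le_mul_of_nonneg_left (hle_F p hp z b) hβ
    simp only [smul_eq_mul]
    rw [hell_aff _ _ _ _ _ _ hab]
    have : β = 1 - α := by linarith
    subst this
    linarith
  have key : ∀ p ∈ P, ∀ t : ℕ,
      ((t : ℝ) * (t + 1) / 2) * ((∑ i, p i * fi i (auxBar x t)) - ρstar p + u (auxBar x t))
        + Lf * ‖x t - xstar‖ ^ 2
      ≤ ((t : ℝ) * (t + 1) / 2) * f xstar + Lf * ‖x 0 - xstar‖ ^ 2 := by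
    intro p hp t
    induction t with
    | zero => simp
    | succ t ih =>
      have hT : (0 : ℝ) < (t : ℝ) + 1 := by positivity
      have hT2 : (0 : ℝ) < (t : ℝ) + 2 := by positivity
      have ht0 : (0 : ℝ) ≤ t := by positivity
      have h3 := aux_three (hFcv (xund (t + 1))) (hX (t + 1)) hxstarX
        (hxupd (t + 1) (by omega)).2
      simp only [Nat.add_sub_cancel] at h3
      push_cast at h3 ⊢
      have hb := auxBar_sub x xund hxund0 hxund (t + 1)
      simp only [Nat.add_sub_cancel] at hb
      push_cast at hb
      have hs := hsmooth p hp (xund (t + 1)) (((2 : ℝ) / (t + 1 + 1)) • (x (t + 1) - x t))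
      rw [← hb] at hs
      have hsum : (t : ℝ) / (t + 2) + 2 / (t + 2) = 1 := by field_simp
      have hbar : auxBar x (t + 1)
        = ((t : ℝ) / (t + 2)) • auxBar x t + ((2 : ℝ) / (t + 2)) • x (t + 1) := rfl
      have hl := hell_aff p (xund (t + 1)) (auxBar x t) (x (t + 1)) _ _ hsum
      rw [← hbar] at hl
      have hu := hucv.2 (Set.mem_univ (auxBar x t)) (Set.mem_univ (x (t + 1)))
        (by positivity) (by positivity) hsum
      rw [← hbar] at hu
      simp only [smul_eq_mul] at hu
      have hl1 := hell_le p hp (xund (t + 1)) (auxBar x t)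
      have hl2 := hle_F p hp (xund (t + 1)) (x (t + 1))
      have hl3 := hF_le (xund (t + 1)) xstar
      rw [norm_smul, mul_pow, Real.norm_of_nonneg (by positivity)] at hs
      rw [norm_sub_rev xstar] at h3
      generalize (∑ i, p i * fi i (auxBar x (t + 1))) = A1 at *
      generalize (∑ i, p i * fi i (auxBar x t)) = A0 at *
      generalize u (auxBar x (t + 1)) = U1 at *
      generalize u (auxBar x t) = U0 at *
      generalize ell p (xund (t + 1)) (auxBar x (t + 1)) = B1 at *
      generalize ell p (xund (t + 1)) (auxBar x t) = B0 at *
      generalize ell p (xund (t + 1)) (x (t + 1)) = B2 at *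
      generalize F (xund (t + 1)) (x (t + 1)) = F1 at *
      generalize F (xund (t + 1)) xstar = Fs at *
      generalize u (x (t + 1)) = V at *
      have hD : 0 ≤ ‖x (t + 1) - x t‖ ^ 2 := by positivity
      generalize ‖x (t + 1) - x t‖ ^ 2 = D at *
      have h3' : (t + 1) * (F1 + V) + Lf * D + Lf * ‖x (t + 1) - xstar‖ ^ 2
          ≤ (t + 1) * (Fs + u xstar) + Lf * ‖x t - xstar‖ ^ 2 := by
        have := mul_le_mul_of_nonneg_left h3 hT.le
        have e : ∀ q : ℝ, ((t : ℝ) + 1) * (2 * Lf / (t + 1) / 2 * q) = Lf * q := by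
          intro q; field_simp
        simp only [mul_add, e] at this ⊢
        linarith
      have hW : (0 : ℝ) ≤ (t + 1) * (t + 1 + 1) / 2 := by positivity
      have hs' := mul_le_mul_of_nonneg_left hs hW
      have hu' := mul_le_mul_of_nonneg_left hu hW
      have e1 : ((t : ℝ) + 1) * (t + 1 + 1) / 2 * (t / (t + 2) * U0 + 2 / (t + 2) * V)
          = t * (t + 1) / 2 * U0 + (t + 1) * V := by
        rw [show (t : ℝ) + 1 + 1 = t + 2 by ring]; field_simp
      have e2 : ((t : ℝ) + 1) * (t + 1 + 1) / 2 * (B1 + Lf / 2 * ((2 / (t + 1 + 1)) ^ 2 * D))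
          = t * (t + 1) / 2 * B0 + (t + 1) * B2 + (t + 1) / (t + 2) * (Lf * D) := by
        rw [hl, show (t : ℝ) + 1 + 1 = t + 2 by ring]; field_simp
      rw [e1] at hu'
      rw [e2] at hs'
      have e3 : ((t : ℝ) + 1) / (t + 2) * (Lf * D) ≤ Lf * D := by
        apply mul_le_of_le_one_left (by positivity)
        rw [div_le_one hT2]; linarith
      have hl1' := mul_le_mul_of_nonneg_left hl1 (show (0 : ℝ) ≤ t * (t + 1) / 2 by positivity)
      have hl2' := mul_le_mul_of_nonneg_left hl2 hT.le
      have hl3' := mul_le_mul_of_nonneg_left hl3 hT.le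
      linarith
  intro t ht
  have hW : (0 : ℝ) < (t : ℝ) * (t + 1) / 2 := by
    have : (0 : ℝ) < t := by exact_mod_cast ht
    positivity
  have hfb : f (auxBar x t) - u (auxBar x t) ≤ f xstar
      + (Lf * ‖x 0 - xstar‖ ^ 2 - Lf * ‖x t - xstar‖ ^ 2) / ((t : ℝ) * (t + 1) / 2)
      - u (auxBar x t) := by
    refine (hf _).2 ?_
    rintro _ ⟨p, hp, rfl⟩
    have := key p hp t
    simp only
    rw [le_sub_iff_add_le, ← sub_le_iff_le_add', le_div_iff₀ hW]
    linarith
  have hmin : f xstar ≤ f (auxBar x t) := hxstar (auxBar_mem hXcv hX t)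
  have h0 : 0 ≤ (Lf * ‖x 0 - xstar‖ ^ 2 - Lf * ‖x t - xstar‖ ^ 2) / ((t : ℝ) * (t + 1) / 2) := by
    linarith
  have h1 : 0 ≤ Lf * ‖x 0 - xstar‖ ^ 2 - Lf * ‖x t - xstar‖ ^ 2 := by
    by_contra hneg
    exact absurd h0 (not_le.2 (div_neg_of_neg_of_pos (not_le.1 hneg) hW))
  have h2 : ‖x t - xstar‖ ^ 2 ≤ ‖x 0 - xstar‖ ^ 2 :=
    le_of_mul_le_mul_left (by linarith) hLfpos
  exact (sq_le_sq₀ (norm_nonneg _) (norm_nonneg _)).1 h2
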